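/- Let ε ∈ [0,1) and T, S ∈ B(H) with ω(T) ≠ 0. Then T ⊥ε_ω S if and only if for every θ ∈ [0, 2π), lim_{r→0⁺} (ω(T + r e^{iθ} S) − ω(T))/r ≥ −ε ω(S). -/

import Mathlib

open Filter Topology
open scoped InnerProductSpace

variable {H : Type*} [NormedAddCommGroup H] [InnerProductSpace ℂ H] [CompleteSpace H]

/-- The numerical radius of a bounded operator `T`:
`ω(T) = sup {|⟨Tx, x⟩| : ‖x‖ = 1}`. -/
noncomputable def nrad (T : H →L[ℂ] H) : ℝ :=
  sSup {r : ℝ | ∃ x : H, ‖x‖ = 1 ∧ r = ‖⟪x, T x⟫_ℂ‖}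

/-- Approximate numerical-radius (Birkhoff) orthogonality:
`T ⊥ε_ω S` iff `ω(T + λS)² ≥ ω(T)² − 2ε ω(T) ω(λS)` for all `λ ∈ ℂ`. -/
def NradOrth (ε : ℝ) (T S : H →L[ℂ] H) : Prop :=
  ∀ μ : ℂ, nrad T ^ 2 - 2 * ε * nrad T * nrad (μ • S) ≤ nrad (T + μ • S) ^ 2

omit [CompleteSpace H] in
lemma norm_inner_apply_le_nrad (T : H →L[ℂ] H) {x : H} (hx : ‖x‖ = 1) :
    ‖⟪x, T x⟫_ℂ‖ ≤ nrad T := by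
  refine le_csSup ⟨‖T‖, ?_⟩ ⟨x, hx, rfl⟩
  rintro _ ⟨y, hy, rfl⟩
  calc ‖⟪y, T y⟫_ℂ‖ ≤ ‖y‖ * ‖T y‖ := norm_inner_le_norm _ _
    _ ≤ ‖T‖ := by simpa [hy] using T.le_opNorm y

omit [CompleteSpace H] in
lemma nrad_nonneg (T : H →L[ℂ] H) : 0 ≤ nrad T := by
  apply Real.sSup_nonneg
  rintro _ ⟨x, -, rfl⟩
  exact norm_nonneg _

omit [CompleteSpace H] in
lemma nrad_le {T : H →L[ℂ] H} {c : ℝ} (hc : 0 ≤ c)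
    (h : ∀ x : H, ‖x‖ = 1 → ‖⟪x, T x⟫_ℂ‖ ≤ c) : nrad T ≤ c := by
  refine Real.sSup_le ?_ hc
  rintro _ ⟨x, hx, rfl⟩
  exact h x hx

variable (H) in
/-- The numerical radius as a seminorm on bounded operators. -/
noncomputable def nradSeminorm : Seminorm ℂ (H →L[ℂ] H) :=
  Seminorm.ofSMulLE nrad
    (le_antisymm (nrad_le le_rfl fun x _ => by simp) (nrad_nonneg _))
    (fun T S => nrad_le (add_nonneg (nrad_nonneg T) (nrad_nonneg S)) fun x hx => by
      rw [add_apply, inner_add_right]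
      exact (norm_add_le _ _).trans
        (add_le_add (norm_inner_apply_le_nrad T hx) (norm_inner_apply_le_nrad S hx)))
    (fun c T => nrad_le (mul_nonneg (norm_nonneg c) (nrad_nonneg T)) fun x hx => by
      rw [smul_apply, inner_smul_right, norm_mul]
      exact mul_le_mul_of_nonneg_left (norm_inner_apply_le_nrad T hx) (norm_nonneg c))

/-- The difference quotients of a seminorm along a ray decrease to a limit as `r → 0⁺`. -/
lemma Seminorm.exists_tendsto_slope {E : Type*} [AddCommGroup E] [Module ℂ E]
    (p : Seminorm ℂ E) (x y : E) :
    ∃ L : ℝ, Tendsto (fun r : ℝ => (p (x + (r : ℂ) • y) - p x) / r) (𝓝[>] 0) (𝓝 L) ∧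
      ∀ r : ℝ, 0 < r → L ≤ (p (x + (r : ℂ) • y) - p x) / r := by
  set f : ℝ → ℝ := fun r => (p (x + (r : ℂ) • y) - p x) / r with hf
  have hmono : MonotoneOn f (Set.Ioi 0) := by
    intro r hr t ht hrt
    rw [Set.mem_Ioi] at hr ht
    have hr' : (t : ℂ) ≠ 0 := by exact_mod_cast ht.ne'
    have hdecomp : (t : ℂ) • (x + (r : ℂ) • y)
        = ((t - r : ℝ) : ℂ) • x + (r : ℂ) • (x + (t : ℂ) • y) := by
      push_cast
      module
    have key : t * p (x + (r : ℂ) • y) ≤ (t - r) * p x + r * p (x + (t : ℂ) • y) := by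
      have h := map_add_le_add p (((t - r : ℝ) : ℂ) • x) ((r : ℂ) • (x + (t : ℂ) • y))
      rw [← hdecomp] at h
      simpa only [map_smul_eq_mul, Complex.norm_real, Real.norm_of_nonneg ht.le,
        Real.norm_of_nonneg hr.le, Real.norm_of_nonneg (sub_nonneg.2 hrt)] using h
    rw [hf]
    dsimp only
    rw [div_le_div_iff₀ hr ht]
    linarith
  have hbdd : BddBelow (f '' Set.Ioi 0) := by
    refine ⟨-p y, ?_⟩
    rintro _ ⟨r, hr, rfl⟩
    rw [Set.mem_Ioi] at hr
    have h := map_sub_le_add p (x + (r : ℂ) • y) ((r : ℂ) • y)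
    rw [add_sub_cancel_right, map_smul_eq_mul, Complex.norm_real, Real.norm_of_nonneg hr.le] at h
    rw [le_div_iff₀ hr]
    linarith
  exact ⟨_, hmono.tendsto_nhdsGT hbdd, fun r hr => csInf_le hbdd ⟨r, hr, rfl⟩⟩

/-- For `ω(T) ≠ 0`, `T ⊥ε_ω S` iff for every `θ ∈ [0, 2π)` the limit
`lim_{r→0⁺} (ω(T + r e^{iθ} S) − ω(T))/r` is at least `−ε ω(S)`. -/
theorem nradOrth_iff_first_order_deriv (ε : ℝ) (hε0 : 0 ≤ ε) (hε1 : ε < 1)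
    (T S : H →L[ℂ] H) (hT : nrad T ≠ 0) :
    NradOrth ε T S ↔
      ∀ θ ∈ Set.Ico (0 : ℝ) (2 * Real.pi), ∃ L : ℝ,
        Tendsto
          (fun r : ℝ =>
            (nrad (T + ((r : ℂ) * Complex.exp ((θ : ℂ) * Complex.I)) • S) - nrad T) / r)
          (𝓝[>] (0 : ℝ)) (𝓝 L) ∧
        -ε * nrad S ≤ L := by
  have hTpos : 0 < nrad T := (nrad_nonneg T).lt_of_ne' hT
  have hsmul : ∀ μ : ℂ, nrad (μ • S) = ‖μ‖ * nrad S := fun μ =>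
    map_smul_eq_mul (nradSeminorm H) μ S
  have slope (θ : ℝ) : ∃ L : ℝ,
      Tendsto
        (fun r : ℝ => (nrad (T + ((r : ℂ) * Complex.exp ((θ : ℂ) * Complex.I)) • S) - nrad T) / r)
        (𝓝[>] (0 : ℝ)) (𝓝 L) ∧
      ∀ r : ℝ, 0 < r →
        L ≤ (nrad (T + ((r : ℂ) * Complex.exp ((θ : ℂ) * Complex.I)) • S) - nrad T) / r := by
    simp only [mul_smul]
    exact (nradSeminorm H).exists_tendsto_slope T (Complex.exp ((θ : ℂ) * Complex.I) • S)
  constructor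
  · intro h θ _
    obtain ⟨L, hL, -⟩ := slope θ
    refine ⟨L, hL, ?_⟩
    set g : ℝ → ℝ := fun r => nrad (T + ((r : ℂ) * Complex.exp ((θ : ℂ) * Complex.I)) • S)
      with hg
    have hid : Tendsto (fun r : ℝ => r) (𝓝[>] (0 : ℝ)) (𝓝 0) := nhdsWithin_le_nhds
    have hsum : Tendsto (fun r => (g r - nrad T) / r * ((g r - nrad T) / r * r + 2 * nrad T))
        (𝓝[>] (0 : ℝ)) (𝓝 (L * (L * 0 + 2 * nrad T))) :=
      hL.mul ((hL.mul hid).add_const _)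
    have hge : -2 * ε * nrad T * nrad S ≤ L * (L * 0 + 2 * nrad T) := by
      refine ge_of_tendsto hsum ?_
      filter_upwards [self_mem_nhdsWithin] with r hr
      rw [Set.mem_Ioi] at hr
      have h1 := h ((r : ℂ) * Complex.exp ((θ : ℂ) * Complex.I))
      rw [hsmul, norm_mul, Complex.norm_exp_ofReal_mul_I, Complex.norm_real,
        Real.norm_of_nonneg hr.le] at h1
      change _ ≤ g r ^ 2 at h1
      rw [div_mul_cancel₀ _ hr.ne', div_mul_eq_mul_div, le_div_iff₀ hr]
      linarith
    refine le_of_mul_le_mul_left ?_ hTpos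
    linarith
  · intro h μ
    rcases eq_or_ne μ 0 with rfl | hμ
    · rw [hsmul]
      simp
    have hr : 0 < ‖μ‖ := norm_pos_iff.2 hμ
    obtain ⟨θ, hθ, hμθ⟩ : ∃ θ ∈ Set.Ico (0 : ℝ) (2 * Real.pi),
        (‖μ‖ : ℂ) * Complex.exp ((θ : ℂ) * Complex.I) = μ := by
      refine ⟨toIcoMod Real.two_pi_pos 0 μ.arg, by
        simpa using toIcoMod_mem_Ico Real.two_pi_pos 0 μ.arg, ?_⟩
      conv_rhs => rw [← Complex.norm_mul_exp_arg_mul_I μ]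
      congr 1
      rw [Complex.exp_eq_exp_iff_exists_int]
      refine ⟨-toIcoDiv Real.two_pi_pos 0 μ.arg, ?_⟩
      rw [toIcoMod]
      push_cast [zsmul_eq_mul]
      ring
    obtain ⟨L', hL', hεL⟩ := h θ hθ
    obtain ⟨L, hL, hle⟩ := slope θ
    obtain rfl := tendsto_nhds_unique hL' hL
    have h1 := hεL.trans (hle _ hr)
    rw [hμθ, le_div_iff₀ hr] at h1
    rw [hsmul]
    nlinarith [sq_nonneg (nrad (T + μ • S) - nrad T), mul_le_mul_of_nonneg_left h1 hTpos.le]
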